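/- Every node left inactive by DMIS has a higher-priority active neighbor: for every vertex v not in the DMIS output set S = ⋃_k L(U_k), there exists a vertex u ∈ S with G.Adj v u and p v < p u. -/

import Mathlib

/-- Set of priority-local maxima of `U` in graph `G`. -/
def locMax {V : Type*} (G : SimpleGraph V) (p : V → ℕ) (U : Set V) : Set V :=
  {v | v ∈ U ∧ ∀ u ∈ U, G.Adj v u → p u < p v}

/-- DMIS phase iteration: undecided vertices after `k` phases. -/
def undecided {V : Type*} (G : SimpleGraph V) (p : V → ℕ) : ℕ → Set V
  | 0 => Set.univ
  | k + 1 =>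
      undecided G p k \
        (locMax G p (undecided G p k) ∪
          {w | ∃ v ∈ locMax G p (undecided G p k), G.Adj v w})

theorem locMax_nonempty {V : Type*} (G : SimpleGraph V) {p : V → ℕ}
    (hp : Function.Injective p) {U : Set V} (hfin : U.Finite) (hU : U.Nonempty) :
    (locMax G p U).Nonempty := by
  obtain ⟨m, hm, hmax⟩ := U.exists_max_image p hfin hU
  exact ⟨m, hm, fun u hu hadj => (hmax u hu).lt_of_ne fun h => hadj.ne (hp h).symm⟩

theorem undecided_succ_ssubset {V : Type*} [Finite V] (G : SimpleGraph V) {p : V → ℕ}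
    (hp : Function.Injective p) {k : ℕ} (hU : (undecided G p k).Nonempty) :
    undecided G p (k + 1) ⊂ undecided G p k := by
  obtain ⟨m, hm⟩ := locMax_nonempty G hp (Set.toFinite _) hU
  exact (Set.ssubset_iff_of_subset Set.sdiff_subset).2 ⟨m, hm.1, fun h => h.2 (Or.inl hm)⟩

theorem exists_notMem_undecided {V : Type*} [Finite V] (G : SimpleGraph V) {p : V → ℕ}
    (hp : Function.Injective p) (v : V) : ∃ k, v ∉ undecided G p k := by
  by_contra! h
  exact not_strictAnti_of_wellFoundedLT (undecided G p)
    (strictAnti_nat_of_succ_lt fun k => undecided_succ_ssubset G hp ⟨v, h k⟩)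

theorem exists_mem_undecided_notMem_succ {V : Type*} [Finite V] (G : SimpleGraph V)
    {p : V → ℕ} (hp : Function.Injective p) (v : V) :
    ∃ k, v ∈ undecided G p k ∧ v ∉ undecided G p (k + 1) := by
  by_contra! h
  obtain ⟨k, hk⟩ := exists_notMem_undecided G hp v
  exact hk (Nat.rec (Set.mem_univ v) h k)

theorem dmis_inactive_has_higher_active_neighbor {V : Type*} [Fintype V]
    (G : SimpleGraph V) (p : V → ℕ) (hp : Function.Injective p) (v : V)
    (hv : v ∉ ⋃ k, locMax G p (undecided G p k)) :
    ∃ u ∈ ⋃ k, locMax G p (undecided G p k), G.Adj v u ∧ p v < p u := by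
  obtain ⟨k, hk, hk'⟩ := exists_mem_undecided_notMem_succ G hp v
  have hdecided : v ∈ locMax G p (undecided G p k) ∪
      {w | ∃ u ∈ locMax G p (undecided G p k), G.Adj u w} :=
    by_contra fun h => hk' ⟨hk, h⟩
  rcases hdecided with hmax | ⟨u, hu, hadj⟩
  · exact absurd (Set.mem_iUnion_of_mem k hmax) hv
  · exact ⟨u, Set.mem_iUnion_of_mem k hu, hadj.symm, hu.2 v hk hadj⟩
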